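/- Let A be a primitive set and q a prime, and let A'_q = {a ∈ A : the least prime factor of a equals q}. Then ∑_{a ∈ A'_q} g(a) ≤ g(q), where for an integer a > 1 with largest prime factor P(a), g(a) = (1/a)·∏_{p prime, p<P(a)}(1 − 1/p). -/

import Mathlib

open scoped BigOperators

/-- A set of positive integers is *primitive* if every element exceeds 1 and
no element divides another element. -/
def IsPrimitive (A : Set ℕ) : Prop :=
  (∀ a ∈ A, 1 < a) ∧ ∀ a ∈ A, ∀ b ∈ A, a ≠ b → ¬ a ∣ b

/-- `P a`: the largest prime factor of `a` (and `0` if `a ≤ 1`). -/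
def maxPrimeFac (a : ℕ) : ℕ := a.primeFactors.sup id

/-- `g a = (1/a) ∏_{p prime, p < P(a)} (1 - 1/p)`. -/
noncomputable def g (a : ℕ) : ℝ :=
  (1 / a) * ∏ p ∈ (maxPrimeFac a).primesBelow, (1 - 1 / (p : ℝ))

/-- The product of the primes smaller than the largest prime factor of `a`. -/
def smallPrimesProd (a : ℕ) : ℕ := ∏ p ∈ (maxPrimeFac a).primesBelow, p

/-- The `n ∈ (0, N]` divisible by `a` whose cofactor `n / a` has no prime factor below the largest
prime factor of `a`. -/
def sievedMultiples (N a : ℕ) : Finset ℕ :=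
  {n ∈ Finset.Ioc 0 N | a ∣ n ∧ (smallPrimesProd a).Coprime (n / a)}

theorem le_maxPrimeFac {a p : ℕ} (hp : p ∈ a.primeFactors) : p ≤ maxPrimeFac a :=
  Finset.le_sup (f := id) hp

theorem maxPrimeFac_prime {q : ℕ} (hq : q.Prime) : maxPrimeFac q = q := by
  simp [maxPrimeFac, hq.primeFactors]

theorem smallPrimesProd_pos (a : ℕ) : 0 < smallPrimesProd a :=
  Finset.prod_pos fun _ hp => (Nat.prime_of_mem_primesBelow hp).pos

theorem coprime_smallPrimesProd_iff {a m : ℕ} :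
    (smallPrimesProd a).Coprime m ↔ ∀ p, p.Prime → p < maxPrimeFac a → ¬ p ∣ m := by
  rw [smallPrimesProd, Nat.coprime_prod_left_iff]
  constructor
  · intro h p hp hlt
    exact hp.coprime_iff_not_dvd.mp (h p (Nat.mem_primesBelow.mpr ⟨hlt, hp⟩))
  · intro h p hp
    obtain ⟨hlt, hp⟩ := Nat.mem_primesBelow.mp hp
    exact hp.coprime_iff_not_dvd.mpr (h p hp hlt)

theorem card_coprime_Ioc_mul (d k : ℕ) :
    (Finset.card {m ∈ Finset.Ioc 0 (d * k) | d.Coprime m}) = k * d.totient := by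
  induction k with
  | zero => simp
  | succ k ih =>
    have hunion : Finset.Ioc 0 (d * (k + 1)) =
        Finset.Ioc 0 (d * k) ∪ Finset.Ico (d * k + 1) (d * k + 1 + d) := by
      ext x
      simp only [Finset.mem_union, Finset.mem_Ioc, Finset.mem_Ico, mul_add, mul_one]
      omega
    rw [hunion, Finset.filter_union, Finset.card_union_of_disjoint, ih,
      Nat.filter_coprime_Ico_eq_totient]
    · ring
    · refine Finset.disjoint_filter_filter (Finset.disjoint_left.mpr fun x hx hx' => ?_)
      simp only [Finset.mem_Ioc, Finset.mem_Ico] at hx hx'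
      omega

theorem totient_smallPrimesProd (a : ℕ) :
    ((smallPrimesProd a).totient : ℝ) =
      smallPrimesProd a * ∏ p ∈ (maxPrimeFac a).primesBelow, (1 - 1 / (p : ℝ)) := by
  have h := Nat.totient_eq_mul_prod_factors (smallPrimesProd a)
  rw [show (smallPrimesProd a).primeFactors = (maxPrimeFac a).primesBelow from
    Nat.primeFactors_prod fun _ hp => Nat.prime_of_mem_primesBelow hp] at h
  simpa using congrArg (fun x : ℚ => (x : ℝ)) h

theorem card_sievedMultiples {N a : ℕ} (ha : 0 < a) (hN : a * smallPrimesProd a ∣ N) :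
    ((sievedMultiples N a).card : ℝ) = N * g a := by
  obtain ⟨k, rfl⟩ := hN
  have himage : sievedMultiples (a * smallPrimesProd a * k) a =
      Finset.image (a * ·)
        {m ∈ Finset.Ioc 0 (smallPrimesProd a * k) | (smallPrimesProd a).Coprime m} := by
    ext n
    simp only [sievedMultiples, Finset.mem_filter, Finset.mem_image, Finset.mem_Ioc]
    constructor
    · rintro ⟨⟨hpos, hle⟩, ⟨m, rfl⟩, hcop⟩
      rw [Nat.mul_div_cancel_left _ ha] at hcop
      rw [mul_assoc] at hle
      exact ⟨m, ⟨⟨Nat.pos_of_mul_pos_left hpos, Nat.le_of_mul_le_mul_left hle ha⟩, hcop⟩, rfl⟩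
    · rintro ⟨m, ⟨⟨hpos, hle⟩, hcop⟩, rfl⟩
      rw [Nat.mul_div_cancel_left _ ha, mul_assoc]
      exact ⟨⟨Nat.mul_pos ha hpos, Nat.mul_le_mul_left a hle⟩, dvd_mul_right a m, hcop⟩
  rw [himage, Finset.card_image_of_injective _ fun _ _ h => Nat.eq_of_mul_eq_mul_left ha h,
    card_coprime_Ioc_mul]
  push_cast
  rw [totient_smallPrimesProd, g]
  field_simp

theorem dvd_of_mul_eq_mul_of_factorization_le {a b m k : ℕ} (h : a * m = b * k)
    (hpos : 0 < a * m) (hle : maxPrimeFac a ≤ maxPrimeFac b)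
    (hk : ∀ p, p.Prime → p < maxPrimeFac b → ¬ p ∣ k)
    (hval : maxPrimeFac a = maxPrimeFac b →
      a.factorization (maxPrimeFac a) ≤ b.factorization (maxPrimeFac a)) : a ∣ b := by
  have ha : a ≠ 0 := by rintro rfl; simp at hpos
  have hm : m ≠ 0 := by rintro rfl; simp at hpos
  have hb : b ≠ 0 := by rintro rfl; simp [h] at hpos
  have hk0 : k ≠ 0 := by rintro rfl; simp [h] at hpos
  rw [← Nat.factorization_prime_le_iff_dvd ha hb]
  intro p hp
  by_cases hpa : p ∣ a
  · rcases (le_maxPrimeFac (hp.mem_primeFactors hpa ha)).trans hle |>.lt_or_eq with hlt | heq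
    · have hfac := congrArg (fun n => n.factorization p) h
      simp only [Nat.factorization_mul ha hm, Nat.factorization_mul hb hk0, Finsupp.add_apply,
        Nat.factorization_eq_zero_of_not_dvd (hk p hp hlt)] at hfac
      omega
    · have hpmax := le_maxPrimeFac (hp.mem_primeFactors hpa ha)
      have hmax : maxPrimeFac a = p := by omega
      simpa [hmax] using hval (hmax.trans heq)
  · simp [Nat.factorization_eq_zero_of_not_dvd hpa]

theorem dvd_or_dvd_of_mem_sievedMultiples {N a b n : ℕ} (ha : n ∈ sievedMultiples N a)
    (hb : n ∈ sievedMultiples N b) : a ∣ b ∨ b ∣ a := by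
  simp only [sievedMultiples, Finset.mem_filter, Finset.mem_Ioc,
    coprime_smallPrimesProd_iff] at ha hb
  obtain ⟨⟨hpos, -⟩, hda, hca⟩ := ha
  obtain ⟨-, hdb, hcb⟩ := hb
  have hna := Nat.mul_div_cancel' hda
  have hnb := Nat.mul_div_cancel' hdb
  have hab := hna.trans hnb.symm
  rcases lt_trichotomy (maxPrimeFac a) (maxPrimeFac b) with hlt | heq | hlt
  · exact .inl (dvd_of_mul_eq_mul_of_factorization_le hab (hpos.trans_eq hna.symm) hlt.le hcb
      fun heq => absurd heq hlt.ne)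
  · rcases le_total (a.factorization (maxPrimeFac a)) (b.factorization (maxPrimeFac a)) with hv | hv
    · exact .inl (dvd_of_mul_eq_mul_of_factorization_le hab (hpos.trans_eq hna.symm) heq.le hcb
        fun _ => hv)
    · exact .inr (dvd_of_mul_eq_mul_of_factorization_le hab.symm (hpos.trans_eq hnb.symm) heq.ge hca
        fun _ => heq ▸ hv)
  · exact .inr (dvd_of_mul_eq_mul_of_factorization_le hab.symm (hpos.trans_eq hnb.symm) hlt.le hca
      fun heq => absurd heq hlt.ne)

theorem sievedMultiples_subset_minFac {N a : ℕ} (ha : 1 < a) :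
    sievedMultiples N a ⊆ sievedMultiples N a.minFac := by
  intro n hn
  have hq := Nat.minFac_prime ha.ne'
  simp only [sievedMultiples, Finset.mem_filter, coprime_smallPrimesProd_iff,
    maxPrimeFac_prime hq] at hn ⊢
  obtain ⟨hI, ⟨m, rfl⟩, hcop⟩ := hn
  rw [Nat.mul_div_cancel_left _ (by omega)] at hcop
  refine ⟨hI, a.minFac_dvd.mul_right m, fun p hp hlt hdvd => ?_⟩
  have hle := le_maxPrimeFac (hq.mem_primeFactors a.minFac_dvd (by omega))
  rcases hp.dvd_mul.mp (hdvd.trans (Nat.div_dvd_of_dvd (a.minFac_dvd.mul_right m))) with h | h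
  · exact absurd (Nat.minFac_le_of_dvd hp.two_le h) (by omega)
  · exact hcop p hp (by omega) h

theorem g_nonneg (a : ℕ) : 0 ≤ g a := by
  refine mul_nonneg (by positivity) (Finset.prod_nonneg fun p hp => ?_)
  have hp1 : (1 : ℝ) ≤ p := by exact_mod_cast (Nat.prime_of_mem_primesBelow hp).one_le
  rw [sub_nonneg, div_le_one (by linarith)]
  exact hp1

theorem g_sum_le_g_q (A : Set ℕ) (hA : IsPrimitive A) (q : ℕ) (hq : q.Prime) :
    ∑' a : {a ∈ A | a.minFac = q}, g a ≤ g q := by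
  refine Real.tsum_le_of_sum_le (fun a => g_nonneg a) fun s => ?_
  let N : ℕ := (q * smallPrimesProd q) * ∏ a ∈ s, (a : ℕ) * smallPrimesProd a
  have hpos (a : {a ∈ A | a.minFac = q}) : 0 < (a : ℕ) := zero_lt_one.trans (hA.1 a a.2.1)
  have hN : 0 < N := Nat.mul_pos (Nat.mul_pos hq.pos (smallPrimesProd_pos q))
    (Finset.prod_pos fun a _ => Nat.mul_pos (hpos a) (smallPrimesProd_pos a))
  have hdisj : (s : Set {a ∈ A | a.minFac = q}).PairwiseDisjoint
      fun a => sievedMultiples N a := by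
    intro a _ b _ hab
    have hne : (a : ℕ) ≠ b := fun h => hab (Subtype.ext h)
    refine Finset.disjoint_left.mpr fun n hna hnb => ?_
    rcases dvd_or_dvd_of_mem_sievedMultiples hna hnb with h | h
    · exact hA.2 a a.2.1 b b.2.1 hne h
    · exact hA.2 b b.2.1 a a.2.1 hne.symm h
  have hsub : (s.biUnion fun a => sievedMultiples N a) ⊆ sievedMultiples N q :=
    Finset.biUnion_subset.mpr fun a _ => by
      simpa only [a.2.2] using sievedMultiples_subset_minFac (N := N) (hA.1 a a.2.1)
  have hcard := Finset.card_le_card hsub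
  rw [Finset.card_biUnion hdisj] at hcard
  have hcardR : ∑ a ∈ s, ((sievedMultiples N a).card : ℝ) ≤ (sievedMultiples N q).card := by
    exact_mod_cast hcard
  rw [card_sievedMultiples hq.pos (dvd_mul_right _ _), Finset.sum_congr rfl fun a ha =>
    card_sievedMultiples (hpos a) ((Finset.dvd_prod_of_mem
      (fun a : {a ∈ A | a.minFac = q} => (a : ℕ) * smallPrimesProd a) ha).mul_left _),
    ← Finset.mul_sum] at hcardR
  exact le_of_mul_le_mul_left hcardR (by exact_mod_cast hN)
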